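/- (First intertwiner-like identity, affine case.) Write Q = q − q⁻¹. In the ring of formal Laurent series in u⁻¹ with coefficients in W_k, for every 1 ≤ i ≤ k−1: ( E_i · Y_{i+1}/(u−Y_{i+1}) − T_i/Q − Y_iY_{i+1}/(u²−Y_iY_{i+1}) ) · ( E_i · Y_i/(u−Y_i) + T_i⁻¹/Q − Y_iY_{i+1}/(u²−Y_iY_{i+1}) ) = −(u² − q²Y_iY_{i+1})(u² − q⁻²Y_iY_{i+1}) / ( Q²(u² − Y_iY_{i+1})² ). -/

import Mathlib

/-- A `C`-algebra `A` together with elements satisfying the defining relations of the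
affine BMW algebra `W_k` with parameters `q, z ∈ Cˣ` and `Z₀⁽ℓ⁾ ∈ C` (`ℓ ∈ ℤ`).
Indexing is 0-based: the paper's `T_i, E_i` (for `1 ≤ i ≤ k-1`) are `T (i-1) _, E (i-1) _`
here, and the paper's `Y_i` (for `1 ≤ i ≤ k`) is `Y (i-1)`.  The fields `Y_zero`, `Y_succ`
say `Y₁ = z X^{ε₁}`, `Y_{i+1} = T_i Y_i T_i`, and `E_def` is the equation
`T_i Y_i = Y_{i+1} T_i - (q - q⁻¹) Y_{i+1} (1 - E_i)` defining `E_i`. -/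
structure AffBMW (C : Type*) [CommRing C] (k : ℕ) (q z : Cˣ) (Z₀ : ℤ → C)
    (A : Type*) [Ring A] [Algebra C A] where
  T : ∀ i : ℕ, i + 1 < k → A
  Tinv : ∀ i : ℕ, i + 1 < k → A
  X : A
  E : ∀ i : ℕ, i + 1 < k → A
  Y : ℕ → A
  Yinv : ℕ → A
  T_Tinv : ∀ i (h : i + 1 < k), T i h * Tinv i h = 1
  Tinv_T : ∀ i (h : i + 1 < k), Tinv i h * T i h = 1
  braid_far : ∀ i j (hi : i + 1 < k) (hj : j + 1 < k), i + 2 ≤ j →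
      T i hi * T j hj = T j hj * T i hi
  braid : ∀ i (h : i + 2 < k),
      T i (by omega) * T (i + 1) h * T i (by omega) =
        T (i + 1) h * T i (by omega) * T (i + 1) h
  XTXT : ∀ h : 1 < k, X * T 0 h * X * T 0 h = T 0 h * X * T 0 h * X
  X_T : ∀ i (h : i + 1 < k), 1 ≤ i → X * T i h = T i h * X
  Y_zero : Y 0 = (z : C) • X
  Y_succ : ∀ i (h : i + 1 < k), Y (i + 1) = T i h * Y i * T i h
  Y_Yinv : ∀ i, i < k → Y i * Yinv i = 1
  Yinv_Y : ∀ i, i < k → Yinv i * Y i = 1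
  E_def : ∀ i (h : i + 1 < k),
      T i h * Y i =
        Y (i + 1) * T i h -
          ((q : C) - ((q⁻¹ : Cˣ) : C)) • (Y (i + 1) * (1 - E i h))
  E_T : ∀ i (h : i + 1 < k), E i h * T i h = ((z⁻¹ : Cˣ) : C) • E i h
  T_E : ∀ i (h : i + 1 < k), T i h * E i h = ((z⁻¹ : Cˣ) : C) • E i h
  E_Tinv : ∀ i (h : i + 1 < k), E i h * Tinv i h = (z : C) • E i h
  Tinv_E : ∀ i (h : i + 1 < k), Tinv i h * E i h = (z : C) • E i h
  ETE_up : ∀ i (h : i + 1 < k) (h' : i + 2 < k),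
      E i h * T (i + 1) h' * E i h = (z : C) • E i h
  ETinvE_up : ∀ i (h : i + 1 < k) (h' : i + 2 < k),
      E i h * Tinv (i + 1) h' * E i h = ((z⁻¹ : Cˣ) : C) • E i h
  ETE_down : ∀ i (h : i + 1 < k) (h' : i - 1 + 1 < k), 1 ≤ i →
      E i h * T (i - 1) h' * E i h = (z : C) • E i h
  ETinvE_down : ∀ i (h : i + 1 < k) (h' : i - 1 + 1 < k), 1 ≤ i →
      E i h * Tinv (i - 1) h' * E i h = ((z⁻¹ : Cˣ) : C) • E i h
  EYE : ∀ (h : 1 < k) (ℓ : ℤ),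
      E 0 h * (if 0 ≤ ℓ then Y 0 ^ ℓ.toNat else Yinv 0 ^ (-ℓ).toNat) * E 0 h =
        Z₀ ℓ • E 0 h
  E_YY : ∀ i (h : i + 1 < k), E i h * (Y i * Y (i + 1)) = E i h
  YY_E : ∀ i (h : i + 1 < k), (Y i * Y (i + 1)) * E i h = E i h

noncomputable section

/-- `a/(u - a) := Σ_{ℓ≥1} a^ℓ u^{-ℓ}`, a formal Laurent series in `u⁻¹`
(an element of `LaurentSeries A = HahnSeries ℤ A` whose variable is `u⁻¹`). -/
def geomU {A : Type*} [Ring A] (a : A) : LaurentSeries A :=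
  HahnSeries.ofPowerSeries ℤ A (PowerSeries.mk fun n => if n = 0 then 0 else a ^ n)

/-- `1/(u - a) := Σ_{ℓ≥1} a^{ℓ-1} u^{-ℓ}`. -/
def invU {A : Type*} [Ring A] (a : A) : LaurentSeries A :=
  HahnSeries.ofPowerSeries ℤ A (PowerSeries.mk fun n => if n = 0 then 0 else a ^ (n - 1))

/-- `a/(u² - a) := Σ_{ℓ≥1} a^ℓ u^{-2ℓ}`. -/
def geomU2 {A : Type*} [Ring A] (a : A) : LaurentSeries A :=
  HahnSeries.ofPowerSeries ℤ A
    (PowerSeries.mk fun n => if n = 0 then 0 else if n % 2 = 0 then a ^ (n / 2) else 0)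

/-- `1/(u² - a) := Σ_{ℓ≥1} a^{ℓ-1} u^{-2ℓ}`. -/
def invU2 {A : Type*} [Ring A] (a : A) : LaurentSeries A :=
  HahnSeries.ofPowerSeries ℤ A
    (PowerSeries.mk fun n => if n = 0 then 0 else if n % 2 = 0 then a ^ (n / 2 - 1) else 0)

/-- `u²/(u² - 1) := Σ_{m≥0} u^{-2m}`. -/
def selfU2 (A : Type*) [Ring A] : LaurentSeries A :=
  HahnSeries.ofPowerSeries ℤ A (PowerSeries.mk fun n => if n % 2 = 0 then 1 else 0)

/-- `1/(u² - 1) := Σ_{m≥1} u^{-2m}`. -/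
def invU2one (A : Type*) [Ring A] : LaurentSeries A :=
  HahnSeries.ofPowerSeries ℤ A
    (PowerSeries.mk fun n => if n = 0 then 0 else if n % 2 = 0 then 1 else 0)

/-- The variable `u` itself (the inverse of the Laurent series variable `u⁻¹`). -/
def Uvar (A : Type*) [Ring A] : LaurentSeries A := HahnSeries.single (-1 : ℤ) 1

/-- A constant Laurent series. -/
def cst {A : Type*} [Ring A] (a : A) : LaurentSeries A := HahnSeries.C a

end

open HahnSeries in
theorem cst_eq_ofPowerSeries {A : Type*} [Ring A] (a : A) :
    cst a = ofPowerSeries ℤ A (PowerSeries.C a) := by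
  rw [cst, ofPowerSeries_C]

theorem cst_mul {A : Type*} [Ring A] (a b : A) : cst (a * b) = cst a * cst b := by
  simp [cst]

theorem cst_smul {C A : Type*} [CommRing C] [Ring A] [Algebra C A] (c : C) (a : A) :
    cst (c • a) = c • cst a := by
  ext n
  simp [cst, HahnSeries.coeff_single]

theorem Uvar_mul_ofPowerSeries_X (A : Type*) [Ring A] :
    Uvar A * HahnSeries.ofPowerSeries ℤ A PowerSeries.X = 1 := by
  rw [HahnSeries.ofPowerSeries_X, Uvar, HahnSeries.single_mul_single]
  simp

theorem Uvar_commute {A : Type*} [Ring A] (x : LaurentSeries A) : Commute (Uvar A) x := by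
  ext n
  have h1 := HahnSeries.coeff_single_mul_add (r := (1 : A)) (x := x) (a := n + 1) (b := -1)
  have h2 := HahnSeries.coeff_mul_single_add (r := (1 : A)) (x := x) (a := n + 1) (b := -1)
  rw [add_neg_cancel_right] at h1 h2
  rw [Uvar, h1, h2, one_mul, mul_one]

theorem geomU_eq_cst_mul_invU {A : Type*} [Ring A] (a : A) : geomU a = cst a * invU a := by
  rw [cst_eq_ofPowerSeries, geomU, invU, ← map_mul]
  congr 1
  ext n
  rw [PowerSeries.coeff_C_mul, PowerSeries.coeff_mk, PowerSeries.coeff_mk]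
  cases n with
  | zero => simp
  | succ n => simp [pow_succ']

theorem geomU2_eq_cst_mul_invU2 {A : Type*} [Ring A] (a : A) :
    geomU2 a = cst a * invU2 a := by
  rw [cst_eq_ofPowerSeries, geomU2, invU2, ← map_mul]
  congr 1
  ext n
  rw [PowerSeries.coeff_C_mul, PowerSeries.coeff_mk, PowerSeries.coeff_mk]
  split_ifs with h0 h1
  · simp
  · rw [← pow_succ']
    congr 1
    omega
  · simp

theorem invU_commute_cst {A : Type*} [Ring A] {a b : A} (h : Commute a b) :
    Commute (invU a) (cst b) := by
  rw [cst_eq_ofPowerSeries, invU]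
  refine Commute.map (f := HahnSeries.ofPowerSeries ℤ A) ?_
  ext n
  rw [PowerSeries.coeff_C_mul, PowerSeries.coeff_mul_C, PowerSeries.coeff_mk]
  split_ifs
  · simp
  · exact h.pow_left _

theorem invU2_commute_cst {A : Type*} [Ring A] {a b : A} (h : Commute a b) :
    Commute (invU2 a) (cst b) := by
  rw [cst_eq_ofPowerSeries, invU2]
  refine Commute.map (f := HahnSeries.ofPowerSeries ℤ A) ?_
  ext n
  rw [PowerSeries.coeff_C_mul, PowerSeries.coeff_mul_C, PowerSeries.coeff_mk]
  split_ifs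
  · simp
  · exact h.pow_left _
  · simp

theorem geomU2_commute_cst {A : Type*} [Ring A] {a b : A} (h : Commute a b) :
    Commute (geomU2 a) (cst b) := by
  rw [geomU2_eq_cst_mul_invU2]
  refine Commute.mul_left ?_ (invU2_commute_cst h)
  rw [Commute, SemiconjBy, ← cst_mul, ← cst_mul, h.eq]

theorem Uvar_sub_cst_mul_invU {A : Type*} [Ring A] (a : A) :
    (Uvar A - cst a) * invU a = 1 := by
  have h : invU a = HahnSeries.ofPowerSeries ℤ A PowerSeries.X * (1 + cst a * invU a) := by
    rw [cst_eq_ofPowerSeries, invU, ← map_mul, ← map_one (HahnSeries.ofPowerSeries ℤ A),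
      ← map_add, ← map_mul]
    congr 1
    ext n
    cases n with
    | zero => simp
    | succ n =>
      rw [PowerSeries.coeff_succ_X_mul, map_add, PowerSeries.coeff_C_mul]
      cases n <;> simp [PowerSeries.coeff_one, pow_succ']
  have h' : Uvar A * invU a = 1 + cst a * invU a := by
    conv_lhs => rw [h, ← mul_assoc, Uvar_mul_ofPowerSeries_X, one_mul]
  rw [sub_mul, h', add_sub_cancel_right]

theorem invU_mul_Uvar_sub_cst {A : Type*} [Ring A] (a : A) :
    invU a * (Uvar A - cst a) = 1 := by
  rw [mul_sub, ← (Uvar_commute (invU a)).eq, (invU_commute_cst (Commute.refl a)).eq, ← sub_mul,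
    Uvar_sub_cst_mul_invU]

theorem Uvar_sq_sub_cst_mul_invU2 {A : Type*} [Ring A] (a : A) :
    (Uvar A ^ 2 - cst a) * invU2 a = 1 := by
  have h : invU2 a =
      HahnSeries.ofPowerSeries ℤ A PowerSeries.X * (HahnSeries.ofPowerSeries ℤ A PowerSeries.X *
        (1 + cst a * invU2 a)) := by
    rw [cst_eq_ofPowerSeries, invU2, ← map_mul, ← map_one (HahnSeries.ofPowerSeries ℤ A),
      ← map_add, ← map_mul, ← map_mul]
    congr 1
    ext n
    match n with
    | 0 => simp
    | 1 => simp [PowerSeries.coeff_succ_X_mul]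
    | n + 2 =>
      rw [PowerSeries.coeff_succ_X_mul, PowerSeries.coeff_succ_X_mul, map_add,
        PowerSeries.coeff_C_mul]
      rcases Nat.eq_zero_or_pos n with rfl | hn
      · simp
      · have hn0 : n ≠ 0 := hn.ne'
        by_cases h2 : n % 2 = 0
        · have h3 : n / 2 = n / 2 - 1 + 1 := by omega
          simp only [PowerSeries.coeff_mk, PowerSeries.coeff_one, hn0, h2, Nat.add_mod_right,
            if_true, if_false, zero_add, ← pow_succ']
          rw [← h3, if_neg (by omega)]
          congr 1
          omega
        · simp [PowerSeries.coeff_one, hn0, h2]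
  have h' : Uvar A ^ 2 * invU2 a = 1 + cst a * invU2 a := by
    conv_lhs => rw [h, pow_two, mul_assoc, ← mul_assoc (Uvar A) (HahnSeries.ofPowerSeries ℤ A _),
      Uvar_mul_ofPowerSeries_X, one_mul, ← mul_assoc, Uvar_mul_ofPowerSeries_X, one_mul]
  rw [sub_mul, h', add_sub_cancel_right]

theorem invU2_mul_Uvar_sq_sub_cst {A : Type*} [Ring A] (a : A) :
    invU2 a * (Uvar A ^ 2 - cst a) = 1 := by
  rw [mul_sub, ← ((Uvar_commute (invU2 a)).pow_left 2).eq,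
    (invU2_commute_cst (Commute.refl a)).eq, ← sub_mul, Uvar_sq_sub_cst_mul_invU2]

theorem Uvar_sub_cst_mul_geomU {A : Type*} [Ring A] (a : A) :
    (Uvar A - cst a) * geomU a = cst a := by
  rw [geomU_eq_cst_mul_invU, ← (invU_commute_cst (Commute.refl a)).eq, ← mul_assoc,
    Uvar_sub_cst_mul_invU, one_mul]

theorem geomU_mul_Uvar_sub_cst {A : Type*} [Ring A] (a : A) :
    geomU a * (Uvar A - cst a) = cst a := by
  rw [geomU_eq_cst_mul_invU, mul_assoc, invU_mul_Uvar_sub_cst, mul_one]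

theorem Uvar_sq_sub_cst_mul_geomU2 {A : Type*} [Ring A] (a : A) :
    (Uvar A ^ 2 - cst a) * geomU2 a = cst a := by
  rw [geomU2_eq_cst_mul_invU2, ← (invU2_commute_cst (Commute.refl a)).eq, ← mul_assoc,
    Uvar_sq_sub_cst_mul_invU2, one_mul]

theorem Commute.invU_right {A : Type*} [Ring A] {x : LaurentSeries A} {a : A}
    (h : Commute x (cst a)) : Commute x (invU a) := by
  have hu : Commute x (Uvar A - cst a) := (Uvar_commute x).symm.sub_right h
  calc x * invU a = invU a * (Uvar A - cst a) * x * invU a := by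
        rw [invU_mul_Uvar_sub_cst, one_mul]
    _ = invU a * x * ((Uvar A - cst a) * invU a) := by
        rw [mul_assoc (invU a), ← hu.eq]
        simp only [mul_assoc]
    _ = invU a * x := by rw [Uvar_sub_cst_mul_invU, mul_one]

theorem Commute.geomU_right {A : Type*} [Ring A] {x : LaurentSeries A} {a : A}
    (h : Commute x (cst a)) : Commute x (geomU a) := by
  rw [geomU_eq_cst_mul_invU]
  exact h.mul_right h.invU_right

theorem mul_eq_of_resolvents {R : Type*} [Ring R] {a b u ia ib g g' G : R} (hab : Commute a b)
    (hua : Commute u a) (hub : Commute u b) (ha : ia * (u - a) = 1) (hb : ib * (u - b) = 1)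
    (hg : (u - a) * g = a) (hg' : (u - b) * g' = b) (hG : (u ^ 2 - a * b) * G = a * b) :
    g' * g = (g' + g + 1) * G := by
  have hX : Commute (u - a) (u - b) :=
    ((Commute.refl u).sub_left hua.symm).sub_right (hub.sub_left hab)
  have hXb : Commute (u - a) b := hub.sub_left hab
  have hinj : ∀ x y : R, (u - a) * ((u - b) * x) = (u - a) * ((u - b) * y) → x = y := by
    intro x y hxy
    have h1 := congrArg (fun w => ib * (ia * w)) hxy
    simpa only [← mul_assoc ia, ha, one_mul, ← mul_assoc ib, hb] using h1
  apply hinj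
  have h1 : (u - a) * ((u - b) * (g' * g)) = a * b := by
    rw [← mul_assoc (u - b), hg', ← mul_assoc, hXb.eq, mul_assoc, hg, hab.eq]
  have h2 : (u - a) * ((u - b) * (g' + g + 1)) = u ^ 2 - a * b := by
    rw [mul_add, mul_add (u - b), hg', mul_add, mul_add, ← mul_assoc _ _ g, hX.eq, mul_assoc, hg, mul_one,
      ← sub_eq_zero]
    have e1 := hua.eq
    have e3 := hab.eq
    noncomm_ring
    simp only [e1, e3]
    abel
  rw [h1, ← mul_assoc (u - b), ← mul_assoc, h2, hG]

/-- `b/(u-b) · a/(u-a) = (b/(u-b) + a/(u-a) + 1) · ab/(u²-ab)` for commuting `a` and `b`. -/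
theorem geomU_mul_geomU {A : Type*} [Ring A] {a b : A} (h : Commute a b) :
    geomU b * geomU a = (geomU b + geomU a + 1) * geomU2 (a * b) := by
  refine mul_eq_of_resolvents (a := cst a) (b := cst b) ?_ (Uvar_commute _) (Uvar_commute _)
    (invU_mul_Uvar_sub_cst a) (invU_mul_Uvar_sub_cst b) (Uvar_sub_cst_mul_geomU a)
    (Uvar_sub_cst_mul_geomU b) ?_
  · rw [Commute, SemiconjBy, ← cst_mul, ← cst_mul, h.eq]
  · rw [← cst_mul, Uvar_sq_sub_cst_mul_geomU2]

theorem resolvent_mul_eq {C R : Type*} [CommRing C] [Ring R] [Algebra C R] {Q : C}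
    {e t ti y y' u i i' g g' : R} (huy' : Commute u y')
    (hti : t - ti = Q • (1 - e)) (hy : y' * ti = t * y)
    (hi : (u - y) * i = 1) (hi' : i' * (u - y') = 1)
    (hg : g * (u - y) = y) (hg' : (u - y') * g' = y') (huti : Commute u ti) :
    g' * ti = t * g + Q • (g' * g) - Q • (g' * e * g) := by
  have hinj : ∀ x w : R, (u - y') * (x * (u - y)) = (u - y') * (w * (u - y)) → x = w := by
    intro x w hxw
    have h1 := congrArg (fun v => i' * v * i) hxw
    simpa only [← mul_assoc i', hi', one_mul, mul_assoc _ _ i, hi, mul_one] using h1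
  apply hinj
  have h1 : (u - y') * (g' * ti * (u - y)) = u * (t * y) - y' * ti * y := by
    rw [mul_assoc g', ← mul_assoc, hg', ← mul_assoc, mul_sub, mul_assoc y' ti u, ← huti.eq,
      ← mul_assoc y' u, ← huy'.eq, mul_assoc u, hy]
  have h2 : t * g + Q • (g' * g) - Q • (g' * e * g) = t * g + g' * (t - ti) * g := by
    rw [hti]
    simp only [mul_smul_comm, smul_mul_assoc, mul_sub, sub_mul, mul_one, smul_sub]
    abel
  rw [h1, h2, add_mul, mul_assoc t, hg, mul_assoc _ g, hg, mul_add, mul_assoc g', ← mul_assoc _ g', hg']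
  noncomm_ring

theorem intertwiner_mul_eq {C R : Type*} [CommRing C] [Ring R] [Algebra C R] {Q c : C}
    (hc : c * Q = 1) {e t ti g g' G : R} (ht : t * ti = 1) (hti : t - ti = Q • (1 - e))
    (het : t * e = e * t) (hGt : Commute G t) (hGe : Commute G e)
    (hg : g' * ti = t * g + Q • (g' * g) - Q • (g' * e * g))
    (hG : g' * g = (g' + g + 1) * G) (hGg : Commute G g) :
    (e * g' - c • t - G) * (e * g + c • ti - G) = G + G * G - (c * c) • (1 : R) := by
  have h1 : c • (e * g' * ti) = c • (e * t * g) + e * ((g' + g + 1) * G) - e * g' * (e * g) := by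
    rw [mul_assoc e g', hg, ← hG]
    simp only [mul_add, mul_sub, smul_add, smul_sub, mul_smul_comm, smul_smul, hc, one_smul,
      mul_assoc]
  have h2 : c • (t * G) - c • (G * ti) = G - e * G := by
    rw [← hGt.eq, ← smul_sub, ← mul_sub, hti, mul_smul_comm, smul_smul, hc, one_smul, mul_sub,
      mul_one, hGe.eq]
  have h3 : (e * g' - c • t - G) * (e * g + c • ti - G) =
      e * g' * (e * g) + c • (e * g' * ti) - e * g' * G - c • (t * e * g) - (c * c) • (t * ti)
        + (c • (t * G) - c • (G * ti)) - G * e * g + G * G := by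
    simp only [mul_add, mul_sub, sub_mul, mul_smul_comm, smul_mul_assoc, smul_sub, smul_smul,
      mul_assoc]
    abel
  rw [h3, h1, h2, ht, het, hGe.eq, mul_assoc e G, hGg.eq]
  noncomm_ring

theorem quadratic_factor_eq {C R : Type*} [CommRing C] [Ring R] [Algebra C R] {q q' c : C}
    (hq : q * q' = 1) (hc : c * (q - q') = 1) {v p N : R} (hvp : Commute v p)
    (hpN : Commute p N) (hD : (v - p) * N = 1) :
    p * N + p * N * (p * N) - (c * c) • (1 : R) =
      -(c • c • ((v - q ^ 2 • p) * (v - q' ^ 2 • p) * (N * N))) := by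
  have h1 : (v - q ^ 2 • p) * (v - q' ^ 2 • p) =
      (v - p) * (v - p) - (q - q') ^ 2 • (v * p) := by
    have e1 : (q - q') ^ 2 = q ^ 2 + q' ^ 2 - 2 := by linear_combination (-2) * hq
    have e2 : q ^ 2 * q' ^ 2 = 1 := by rw [← mul_pow, hq, one_pow]
    simp only [mul_sub, sub_mul, mul_smul_comm, smul_mul_assoc, smul_sub, smul_smul, e1, ← hvp.eq,
      sub_smul, add_smul, two_smul, mul_comm (q' ^ 2) (q ^ 2), e2, one_smul]
    abel
  have h2 : (v - p) * (v - p) * (N * N) = 1 := by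
    rw [mul_assoc, ← mul_assoc _ N N, hD, one_mul, hD]
  have h3 : v * p * (N * N) = p * N + p * N * (p * N) := by
    have e : v = (v - p) + p := by abel
    rw [hvp.eq, mul_assoc, ← mul_assoc v]
    nth_rw 1 [e]
    rw [add_mul, hD, add_mul, one_mul, mul_add, mul_assoc p N (p * N), ← mul_assoc N p N,
      ← hpN.eq, mul_assoc p N N]
  have h4 : c * c * (q - q') ^ 2 = 1 := by
    linear_combination (c * (q - q') + 1) * hc
  rw [h1, sub_mul, h2, smul_mul_assoc, h3, smul_sub, smul_sub, smul_smul, smul_smul, smul_smul, h4,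
    one_smul]
  abel

namespace AffBMW

variable {C : Type*} [CommRing C] {k : ℕ} {q z : Cˣ} {Z₀ : ℤ → C} {A : Type*} [Ring A]
  [Algebra C A]

theorem Y_commute_T (B : AffBMW C k q z Z₀ A) (i : ℕ) :
    ∀ j (h : j + 1 < k), i < j → Commute (B.Y i) (B.T j h) := by
  induction i with
  | zero =>
    intro j h hj
    rw [B.Y_zero]
    exact Commute.smul_left (B.X_T j h hj) _
  | succ i ih =>
    intro j h hj
    have hi : i + 1 < k := by omega
    have hT : Commute (B.T i hi) (B.T j h) := B.braid_far i j hi h (by omega)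
    rw [B.Y_succ i hi]
    exact (hT.mul_left (ih j h (by omega))).mul_left hT

theorem Y_T_Y_T (B : AffBMW C k q z Z₀ A) (i : ℕ) : ∀ h : i + 1 < k,
    B.Y i * B.T i h * B.Y i * B.T i h = B.T i h * B.Y i * B.T i h * B.Y i := by
  induction i with
  | zero =>
    intro h
    have := B.XTXT h
    simp only [B.Y_zero, smul_mul_assoc, mul_smul_comm, this]
  | succ i ih =>
    intro h
    have hi : i + 1 < k := by omega
    have hyb := (B.Y_commute_T i (i + 1) h (by omega)).eq
    have hb := B.braid i h
    have hY := ih hi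
    rw [B.Y_succ i hi]
    generalize B.T i hi = a at *
    generalize B.T (i + 1) h = b at *
    generalize B.Y i = y at *
    calc a * y * a * b * (a * y * a) * b = a * y * (a * b * a) * y * a * b := by noncomm_ring
      _ = a * (y * b) * a * (b * y) * a * b := by rw [hb]; noncomm_ring
      _ = a * (b * y) * a * (y * b) * a * b := by rw [hyb]
      _ = a * b * y * a * y * (b * a * b) := by noncomm_ring
      _ = a * b * (y * a * y * a) * b * a := by rw [← hb]; noncomm_ring
      _ = (a * b * a) * y * a * y * b * a := by rw [hY]; noncomm_ring
      _ = b * a * (b * y) * a * (y * b) * a := by rw [hb]; noncomm_ring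
      _ = b * a * (y * b) * a * (b * y) * a := by rw [hyb]
      _ = b * a * y * (b * a * b) * y * a := by noncomm_ring
      _ = b * (a * y * a) * b * (a * y * a) := by rw [← hb]; noncomm_ring

theorem Y_commute_Y_succ (B : AffBMW C k q z Z₀ A) (i : ℕ) (h : i + 1 < k) :
    Commute (B.Y i) (B.Y (i + 1)) := by
  have := B.Y_T_Y_T i h
  rw [B.Y_succ i h, Commute, SemiconjBy]
  simpa only [mul_assoc] using this

theorem Y_mul_Y_succ_commute_T (B : AffBMW C k q z Z₀ A) (i : ℕ) (h : i + 1 < k) :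
    Commute (B.Y i * B.Y (i + 1)) (B.T i h) := by
  have := B.Y_T_Y_T i h
  rw [B.Y_succ i h, Commute, SemiconjBy]
  calc B.Y i * (B.T i h * B.Y i * B.T i h) * B.T i h
      = B.Y i * B.T i h * B.Y i * B.T i h * B.T i h := by simp only [mul_assoc]
    _ = B.T i h * (B.Y i * (B.T i h * B.Y i * B.T i h)) := by rw [this]; simp only [mul_assoc]

theorem Y_succ_mul_Tinv (B : AffBMW C k q z Z₀ A) (i : ℕ) (h : i + 1 < k) :
    B.Y (i + 1) * B.Tinv i h = B.T i h * B.Y i := by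
  rw [B.Y_succ i h, mul_assoc, B.T_Tinv, mul_one]

theorem T_sub_Tinv (B : AffBMW C k q z Z₀ A) (i : ℕ) (h : i + 1 < k) :
    B.T i h - B.Tinv i h = ((q : C) - ((q⁻¹ : Cˣ) : C)) • (1 - B.E i h) := by
  have h1 := B.E_def i h
  rw [← B.Y_succ_mul_Tinv i h] at h1
  have h2 : B.Y (i + 1) * (B.T i h - B.Tinv i h) =
      B.Y (i + 1) * (((q : C) - ((q⁻¹ : Cˣ) : C)) • (1 - B.E i h)) := by
    rw [mul_sub, h1, sub_sub_cancel, mul_smul_comm]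
  have h3 := congrArg (fun x => B.Yinv (i + 1) * x) h2
  simpa only [← mul_assoc, B.Yinv_Y (i + 1) h, one_mul] using h3

end AffBMW

/-- first intertwiner-like identity, affine case; (3.28) of the paper:
with `Q = q - q⁻¹`, in formal Laurent series in `u⁻¹` over `W_k` (0-indexed),
`(Eᵢ Y_{i+1}/(u-Y_{i+1}) - Tᵢ/Q - YᵢY_{i+1}/(u²-YᵢY_{i+1}))
   (Eᵢ Yᵢ/(u-Yᵢ) + Tᵢ⁻¹/Q - YᵢY_{i+1}/(u²-YᵢY_{i+1}))
 = -(u²-q²YᵢY_{i+1})(u²-q⁻²YᵢY_{i+1}) / (Q²(u²-YᵢY_{i+1})²)`. -/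
theorem affine_BMW_first_intertwiner
    (C : Type*) [CommRing C] (k : ℕ) (q z : Cˣ) (Z₀ : ℤ → C)
    (A : Type*) [Ring A] [Algebra C A]
    [Invertible ((q : C) - ((q⁻¹ : Cˣ) : C))]
    (hk : 2 ≤ k)
    (B : AffBMW C k q z Z₀ A) :
    ∀ i (h : i + 1 < k),
      (cst (B.E i h) * geomU (B.Y (i + 1)) -
            ⅟((q : C) - ((q⁻¹ : Cˣ) : C)) • cst (B.T i h) -
            geomU2 (B.Y i * B.Y (i + 1))) *
          (cst (B.E i h) * geomU (B.Y i) +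
            ⅟((q : C) - ((q⁻¹ : Cˣ) : C)) • cst (B.Tinv i h) -
            geomU2 (B.Y i * B.Y (i + 1))) =
        -(⅟((q : C) - ((q⁻¹ : Cˣ) : C)) • ⅟((q : C) - ((q⁻¹ : Cˣ) : C)) •
            ((Uvar A ^ 2 - (q : C) ^ 2 • cst (B.Y i * B.Y (i + 1))) *
              (Uvar A ^ 2 - ((q⁻¹ : Cˣ) : C) ^ 2 • cst (B.Y i * B.Y (i + 1))) *
              (invU2 (B.Y i * B.Y (i + 1)) * invU2 (B.Y i * B.Y (i + 1))))) := by
  intro i h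
  have hYY : Commute (B.Y i) (B.Y (i + 1)) := B.Y_commute_Y_succ i h
  have hPY : Commute (B.Y i * B.Y (i + 1)) (B.Y i) := (Commute.refl _).mul_left hYY.symm
  have hP : Commute (B.Y i * B.Y (i + 1)) (B.T i h) := B.Y_mul_Y_succ_commute_T i h
  have hPE : Commute (B.Y i * B.Y (i + 1)) (B.E i h) := (B.YY_E i h).trans (B.E_YY i h).symm
  have hc : ⅟((q : C) - ((q⁻¹ : Cˣ) : C)) * ((q : C) - ((q⁻¹ : Cˣ) : C)) = 1 := invOf_mul_self _
  have hti : cst (B.T i h) - cst (B.Tinv i h) =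
      ((q : C) - ((q⁻¹ : Cˣ) : C)) • (1 - cst (B.E i h)) := by
    have h1 : cst (B.T i h - B.Tinv i h) = cst (B.T i h) - cst (B.Tinv i h) := by simp [cst]
    have h2 : cst (1 - B.E i h) = 1 - cst (B.E i h) := by simp [cst]
    rw [← h1, ← h2, B.T_sub_Tinv, cst_smul]
  have ht : cst (B.T i h) * cst (B.Tinv i h) = 1 := by
    rw [← cst_mul, B.T_Tinv]
    simp [cst]
  have het : cst (B.T i h) * cst (B.E i h) = cst (B.E i h) * cst (B.T i h) := by
    rw [← cst_mul, ← cst_mul, B.T_E, B.E_T]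
  have hy : cst (B.Y (i + 1)) * cst (B.Tinv i h) = cst (B.T i h) * cst (B.Y i) := by
    rw [← cst_mul, ← cst_mul, B.Y_succ_mul_Tinv]
  have hg := resolvent_mul_eq (Uvar_commute _) hti hy
    (Uvar_sub_cst_mul_invU (B.Y i)) (invU_mul_Uvar_sub_cst (B.Y (i + 1)))
    (geomU_mul_Uvar_sub_cst (B.Y i)) (Uvar_sub_cst_mul_geomU (B.Y (i + 1))) (Uvar_commute _)
  rw [intertwiner_mul_eq hc ht hti het (geomU2_commute_cst hP) (geomU2_commute_cst hPE) hg
      (geomU_mul_geomU hYY) (geomU2_commute_cst hPY).geomU_right, geomU2_eq_cst_mul_invU2]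
  exact quadratic_factor_eq (Units.mul_inv q) hc ((Uvar_commute _).pow_left 2)
    (invU2_commute_cst (Commute.refl _)).symm (Uvar_sq_sub_cst_mul_invU2 _)
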